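/- arXiv:2402.05230 — 2 statements merged into one kernel-verified Lean document; each statement's English description precedes it below -/
import Mathlib

section
/- For every σ > 0, lim_{|ξ|→∞} M_{α,β}(ξ) = (1/Γ(β)) ∫₀^∞ φ₀(r) J̄_n(r) dr. -/
open MeasureTheory Filter Real Complex Topology ENNReal

/-- The Mittag-Leffler function `E_{α,β}(z) = ∑_{k=0}^∞ z^k / Γ(αk + β)`. -/
noncomputable def mittagLeffler (a b : ℝ) (z : ℂ) : ℂ :=
  ∑' k : ℕ, z ^ k / Complex.Gamma (((a * k + b : ℝ) : ℂ))

/-- The Bessel function of the first kind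
`J_λ(r) = (2^{-λ} r^λ / (Γ(1/2) Γ(λ+1/2))) ∫_{-1}^1 e^{irs} (1-s²)^{λ-1/2} ds`. -/
noncomputable def besselJ (lam : ℂ) (r : ℝ) : ℂ :=
  (2 : ℂ) ^ (-lam) * (r : ℂ) ^ lam / (Complex.Gamma (1/2) * Complex.Gamma (lam + 1/2)) *
    ∫ s in (-1:ℝ)..1, Complex.exp (Complex.I * r * s) * (((1 - s ^ 2 : ℝ)) : ℂ) ^ (lam - 1/2)

/-- `J_{-1/2}(r) = √(2/π) r^{-1/2} cos r`. -/
noncomputable def besselJNegHalf (r : ℝ) : ℂ :=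
  ((Real.sqrt (2 / Real.pi) * r ^ (-(1/2) : ℝ) * Real.cos r : ℝ) : ℂ)

/-- `J̄_n(r) = J_{n/2-1}(2πr) r^{n/2}`, using `J_{-1/2}` when `n = 1`. -/
noncomputable def besselJbar (n : ℕ) (r : ℝ) : ℂ :=
  (if n = 1 then besselJNegHalf (2 * Real.pi * r)
    else besselJ ((n : ℂ) / 2 - 1) (2 * Real.pi * r)) * ((r ^ ((n : ℝ) / 2) : ℝ) : ℂ)

/-- `M_{α,β}(ξ) = ∫₀^∞ φ₀(r) E_{α,β}(e^{iφ} r^σ/|ξ|^σ) J̄_n(r) dr`. -/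
noncomputable def Mfun (n : ℕ) (a b s p : ℝ) (cut : ℝ → ℝ) (ξ : EuclideanSpace ℝ (Fin n)) : ℂ :=
  ∫ r in Set.Ioi (0:ℝ), ((cut r : ℝ) : ℂ) *
    mittagLeffler a b (Complex.exp (Complex.I * p) * ((r ^ s / ‖ξ‖ ^ s : ℝ) : ℂ)) *
    besselJbar n r

theorem summable_half_pow_mul_norm_inv_Gamma {a : ℝ} (ha : 0 < a) (b : ℝ) :
    Summable fun k : ℕ => (1 / 2 : ℝ) ^ k * ‖(Complex.Gamma ((a * k + b : ℝ) : ℂ))⁻¹‖ := by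
  refine summable_geometric_two.of_norm_bounded_eventually_nat ?_
  have htends : Tendsto (fun k : ℕ => a * k + b) atTop atTop :=
    tendsto_atTop_add_const_right _ _ (tendsto_natCast_atTop_atTop.const_mul_atTop ha)
  filter_upwards [htends.eventually_ge_atTop 2] with k hk
  have hGamma : 1 ≤ Real.Gamma (a * k + b) := by
    simpa [Real.Gamma_two] using
      Real.Gamma_strictMonoOn_Ici.monotoneOn (Set.mem_Ici.2 le_rfl) (Set.mem_Ici.2 hk) hk
  rw [Complex.Gamma_ofReal, norm_mul, norm_norm, norm_inv, Complex.norm_real,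
    Real.norm_of_nonneg (zero_le_one.trans hGamma), Real.norm_of_nonneg (by positivity)]
  exact mul_le_of_le_one_right (by positivity) (inv_le_one_of_one_le₀ hGamma)

theorem norm_mittagLeffler_term_le (a b : ℝ) (k : ℕ) {z : ℂ}
    (hz : z ∈ Metric.closedBall (0 : ℂ) (1 / 2)) :
    ‖z ^ k / Complex.Gamma ((a * k + b : ℝ) : ℂ)‖ ≤
      (1 / 2 : ℝ) ^ k * ‖(Complex.Gamma ((a * k + b : ℝ) : ℂ))⁻¹‖ := by
  rw [div_eq_mul_inv, norm_mul, norm_pow]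
  have := mem_closedBall_zero_iff.1 hz
  gcongr

theorem continuousOn_mittagLeffler {a : ℝ} (ha : 0 < a) (b : ℝ) :
    ContinuousOn (mittagLeffler a b) (Metric.closedBall 0 (1 / 2)) :=
  continuousOn_tsum (fun _ => by fun_prop) (summable_half_pow_mul_norm_inv_Gamma ha b)
    fun k _ hz => norm_mittagLeffler_term_le a b k hz

theorem mittagLeffler_zero (a b : ℝ) : mittagLeffler a b 0 = (Complex.Gamma (b : ℂ))⁻¹ := by
  rw [mittagLeffler, tsum_eq_single 0 fun k hk => by simp [hk]]
  simp

theorem measurable_besselJ (lam : ℂ) : Measurable (besselJ lam) := by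
  unfold besselJ
  refine Measurable.mul (by fun_prop) ?_
  simp only [intervalIntegral.integral_of_le (show (-1 : ℝ) ≤ 1 by norm_num)]
  refine StronglyMeasurable.measurable (StronglyMeasurable.integral_prod_right ?_)
  refine Measurable.stronglyMeasurable ?_
  unfold Function.uncurry
  fun_prop

theorem measurable_besselJbar (n : ℕ) : Measurable (besselJbar n) := by
  unfold besselJbar
  have hJ : Measurable fun r : ℝ => besselJ ((n : ℂ) / 2 - 1) (2 * Real.pi * r) :=
    (measurable_besselJ _).comp (by fun_prop)
  have hJ' : Measurable fun r : ℝ => besselJNegHalf (2 * Real.pi * r) := by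
    unfold besselJNegHalf
    fun_prop
  refine Measurable.mul ?_ (by fun_prop)
  split_ifs
  exacts [hJ', hJ]

theorem norm_besselJ_le {v r : ℝ} (hr : 0 < r) :
    ‖besselJ v r‖ ≤ ‖(2 : ℂ) ^ (-v : ℂ)‖ * r ^ v /
      ‖Complex.Gamma (1 / 2) * Complex.Gamma (v + 1 / 2)‖ *
        ∫ s in (-1 : ℝ)..1, ‖((1 - s ^ 2 : ℝ) : ℂ) ^ (v - 1 / 2 : ℂ)‖ := by
  rw [besselJ, norm_mul, norm_div, norm_mul, Complex.norm_cpow_eq_rpow_re_of_pos hr, ofReal_re]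
  gcongr
  refine (intervalIntegral.norm_integral_le_integral_norm (by norm_num)).trans_eq ?_
  congr 1 with s
  rw [norm_mul, mul_assoc, ← Complex.ofReal_mul, mul_comm I, Complex.norm_exp_ofReal_mul_I, one_mul]

theorem exists_norm_besselJbar_le {n : ℕ} (hn : 1 ≤ n) :
    ∃ C, ∀ r ∈ Set.Ioc (0 : ℝ) 2, ‖besselJbar n r‖ ≤ C := by
  obtain rfl | hn := hn.eq_or_lt
  · refine ⟨√(2 / Real.pi) * (2 * Real.pi) ^ (-(1 / 2) : ℝ), fun r hr => ?_⟩
    have hpow : (r : ℝ) ^ (-(1 / 2) : ℝ) * r ^ ((1 : ℝ) / 2) = 1 := by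
      rw [← Real.rpow_add hr.1]
      norm_num
    rw [besselJbar, if_pos rfl, besselJNegHalf, ← Complex.ofReal_mul, Complex.norm_real,
      Real.mul_rpow (by positivity) hr.1.le, Nat.cast_one]
    have hrw : √(2 / Real.pi) * ((2 * Real.pi) ^ (-(1 / 2) : ℝ) * r ^ (-(1 / 2) : ℝ)) *
        Real.cos (2 * Real.pi * r) * r ^ ((1 : ℝ) / 2) =
        √(2 / Real.pi) * (2 * Real.pi) ^ (-(1 / 2) : ℝ) * Real.cos (2 * Real.pi * r) := by
      linear_combination (√(2 / Real.pi) * (2 * Real.pi) ^ (-(1 / 2) : ℝ) *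
        Real.cos (2 * Real.pi * r)) * hpow
    rw [hrw, norm_mul, Real.norm_of_nonneg (by positivity)]
    exact mul_le_of_le_one_right (by positivity) (Real.abs_cos_le_one _)
  · have hv : (0 : ℝ) ≤ n / 2 - 1 := by
      have : (2 : ℝ) ≤ n := by exact_mod_cast hn
      linarith
    have hcast : ((n : ℂ) / 2 - 1) = ((n / 2 - 1 : ℝ) : ℂ) := by push_cast; rfl
    set v : ℝ := n / 2 - 1
    refine ⟨‖(2 : ℂ) ^ (-v : ℂ)‖ * (2 * Real.pi * 2) ^ v /
      ‖Complex.Gamma (1 / 2) * Complex.Gamma (v + 1 / 2)‖ *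
        (∫ s in (-1 : ℝ)..1, ‖((1 - s ^ 2 : ℝ) : ℂ) ^ (v - 1 / 2 : ℂ)‖) * 2 ^ ((n : ℝ) / 2),
      fun r hr => ?_⟩
    have hr0 := hr.1
    have hr2 := hr.2
    have hint : 0 ≤ ∫ s in (-1 : ℝ)..1, ‖((1 - s ^ 2 : ℝ) : ℂ) ^ (v - 1 / 2 : ℂ)‖ :=
      intervalIntegral.integral_nonneg (by norm_num) fun _ _ => norm_nonneg _
    rw [besselJbar, if_neg hn.ne', hcast, norm_mul, Complex.norm_real,
      Real.norm_of_nonneg (by positivity)]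
    refine mul_le_mul ((norm_besselJ_le (by positivity)).trans ?_) (by gcongr)
      (by positivity) (by positivity)
    gcongr

theorem stmt10 (n : ℕ) (hn : 1 ≤ n) (α β σ φ : ℝ)
    (hα0 : 0 < α) (hα2 : α < 2) (hβ : 0 < β) (hσ0 : 0 < σ)
    (hφ1 : -Real.pi < φ) (hφ2 : φ ≤ Real.pi) (hφα : α * Real.pi / 2 < |φ|) (φ₀ : ℝ → ℝ) (hcut_smooth : ContDiff ℝ (⊤ : ℕ∞) φ₀)
    (hcut_range : ∀ r, 0 ≤ φ₀ r ∧ φ₀ r ≤ 1)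
    (hcut_one : ∀ r ∈ Set.Icc (-1:ℝ) 1, φ₀ r = 1)
    (hcut_supp : Function.support φ₀ ⊆ Set.Icc (-2:ℝ) 2) :
    Tendsto (Mfun n α β σ φ φ₀)
      (Filter.comap (fun ξ : EuclideanSpace ℝ (Fin n) => ‖ξ‖) atTop)
      (𝓝 ((Complex.Gamma ((β : ℝ) : ℂ))⁻¹ *
        ∫ r in Set.Ioi (0:ℝ), ((φ₀ r : ℝ) : ℂ) * besselJbar n r)) := by
  set B := Metric.closedBall (0 : ℂ) (1 / 2)
  have hcut_zero : ∀ r ∈ Set.Ioi (0 : ℝ) \ Set.Ioc 0 2, φ₀ r = 0 := fun r hr => by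
    by_contra hne
    exact hr.2 ⟨hr.1, (hcut_supp hne).2⟩
  obtain ⟨C, hC⟩ := exists_norm_besselJbar_le hn
  obtain ⟨K, hK⟩ := (isCompact_closedBall (0 : ℂ) (1 / 2)).exists_bound_of_continuousOn
    (continuousOn_mittagLeffler hα0 β)
  have hE : ContinuousAt (mittagLeffler α β) 0 :=
    (continuousOn_mittagLeffler hα0 β).continuousAt (Metric.closedBall_mem_nhds _ (by norm_num))
  let w : EuclideanSpace ℝ (Fin n) → ℝ → ℂ := fun ξ r =>
    Complex.exp (Complex.I * φ) * ((r ^ σ / ‖ξ‖ ^ σ : ℝ) : ℂ)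
  have hw_norm : ∀ ξ r, 0 < r → ‖w ξ r‖ = r ^ σ / ‖ξ‖ ^ σ := fun ξ r hr => by
    rw [norm_mul, mul_comm I, Complex.norm_exp_ofReal_mul_I, one_mul, Complex.norm_real,
      Real.norm_of_nonneg (by positivity)]
  have hdecay : ∀ c : ℝ, Tendsto (fun ξ : EuclideanSpace ℝ (Fin n) => c / ‖ξ‖ ^ σ)
      (comap (fun ξ : EuclideanSpace ℝ (Fin n) => ‖ξ‖) atTop) (𝓝 0) := fun c =>
    ((tendsto_rpow_atTop hσ0).comp tendsto_comap).const_div_atTop c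
  have hw_mem : ∀ᶠ ξ in comap (fun ξ : EuclideanSpace ℝ (Fin n) => ‖ξ‖) atTop,
      ∀ r ∈ Set.Ioc (0 : ℝ) 2, w ξ r ∈ B := by
    filter_upwards [(hdecay (2 ^ σ)).eventually_le_const (show (0 : ℝ) < 1 / 2 by norm_num)]
      with ξ hξ r hr
    have hr0 := hr.1
    have hr2 := hr.2
    rw [mem_closedBall_zero_iff, hw_norm ξ r hr0]
    refine le_trans ?_ hξ
    gcongr
  have hM : Mfun n α β σ φ φ₀ = fun ξ => ∫ r in Set.Ioc (0 : ℝ) 2,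
      (φ₀ r : ℂ) * mittagLeffler α β (w ξ r) * besselJbar n r := by
    ext ξ
    exact setIntegral_eq_of_subset_of_forall_sdiff_eq_zero measurableSet_Ioi
      Set.Ioc_subset_Ioi_self fun r hr => by simp [hcut_zero r hr]
  have hlim : (Complex.Gamma (β : ℂ))⁻¹ * ∫ r in Set.Ioi (0 : ℝ), (φ₀ r : ℂ) * besselJbar n r =
      ∫ r in Set.Ioc (0 : ℝ) 2, (φ₀ r : ℂ) * mittagLeffler α β 0 * besselJbar n r := by
    rw [setIntegral_eq_of_subset_of_forall_sdiff_eq_zero measurableSet_Ioi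
      (show Set.Ioc (0 : ℝ) 2 ⊆ Set.Ioi 0 from Set.Ioc_subset_Ioi_self)
        fun r hr => by simp [hcut_zero r hr],
      ← integral_const_mul, mittagLeffler_zero]
    congr 1 with r
    ring
  rw [hM, hlim]
  refine tendsto_integral_filter_of_dominated_convergence (fun _ => 1 * K * C) ?_ ?_
    (integrable_const _) ?_
  · filter_upwards [hw_mem] with ξ hξ
    have hw_cont : Continuous (w ξ) := by
      have := Real.continuous_rpow_const hσ0.le
      fun_prop
    have hcont : ContinuousOn (fun r => mittagLeffler α β (w ξ r)) (Set.Ioc 0 2) :=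
      (continuousOn_mittagLeffler hα0 β).comp hw_cont.continuousOn hξ
    have hcut : Continuous fun r => (φ₀ r : ℂ) :=
      continuous_ofReal.comp hcut_smooth.continuous
    exact (hcut.aestronglyMeasurable.mul (hcont.aestronglyMeasurable measurableSet_Ioc)).mul
      (measurable_besselJbar n).aestronglyMeasurable
  · filter_upwards [hw_mem] with ξ hξ
    filter_upwards [ae_restrict_mem measurableSet_Ioc] with r hr
    have hK0 : 0 ≤ K := (norm_nonneg _).trans (hK _ (hξ r hr))
    rw [norm_mul, norm_mul, Complex.norm_real, Real.norm_of_nonneg (hcut_range r).1]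
    gcongr
    exacts [(hcut_range r).2, hK _ (hξ r hr), hC r hr]
  · filter_upwards [ae_restrict_mem measurableSet_Ioc] with r hr
    have hw : Tendsto (fun ξ => w ξ r)
        (comap (fun ξ : EuclideanSpace ℝ (Fin n) => ‖ξ‖) atTop) (𝓝 0) := by
      rw [tendsto_zero_iff_norm_tendsto_zero]
      simpa only [hw_norm _ r hr.1] using hdecay (r ^ σ)
    exact ((hE.tendsto.comp hw).const_mul _).mul_const _
end

section
/- Let a ∈ ℝ with a < −1, let m ≥ 0 and j ≥ 0 be integers, and for ξ ∈ ℝⁿ \ {0} define Q_j^{±}(ξ) := ∫₀^∞ e^{±ir} r^{a+m} ψ^{(m)}(r) ∮_ω e^{z^{1/α}} z^{(1−β)/α} (r^{jσ}/|ξ|^{jσ}) (z − e^{iφ} r^σ/|ξ|^σ)^{−(j+1)} dz dr (an absolutely convergent integral). Then lim_{ξ→0, ξ≠0} |ξ|^{−σ} Q_j^{±}(ξ) = e^{i(j+1)(π−φ)} (∮_ω e^{z^{1/α}} z^{(1−β)/α} dz) ∫₀^∞ e^{±ir} r^{a+m−σ} ψ^{(m)}(r) dr, for each choice of sign. -/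
open MeasureTheory Filter Real Complex Topology ENNReal

/-- The contour integral `∮_ω F(z) dz` over the contour `C_ω` consisting of the two rays
`{ρ e^{±iω} : ρ ≥ 1}` and the arc `{e^{iθ} : |θ| ≤ ω}`:
`∮_ω F = ∫₁^∞ F(ρe^{iω}) e^{iω} dρ − ∫₁^∞ F(ρe^{−iω}) e^{−iω} dρ + i ∫_{−ω}^{ω} F(e^{iθ}) e^{iθ} dθ`. -/
noncomputable def contourIntegral (ω : ℝ) (F : ℂ → ℂ) : ℂ :=
  (∫ ρ in Set.Ioi (1:ℝ), F ((ρ : ℂ) * Complex.exp (Complex.I * ω)) * Complex.exp (Complex.I * ω))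
  - (∫ ρ in Set.Ioi (1:ℝ),
      F ((ρ : ℂ) * Complex.exp (-(Complex.I) * ω)) * Complex.exp (-(Complex.I) * ω))
  + Complex.I * ∫ θ in (-ω)..ω, F (Complex.exp (Complex.I * θ)) * Complex.exp (Complex.I * θ)

/-- The kernel `z ↦ e^{z^{1/α}} z^{(1−β)/α}`, with principal complex powers. -/
noncomputable def mlKer (a b : ℝ) (z : ℂ) : ℂ :=
  Complex.exp (z ^ (((1 / a : ℝ)) : ℂ)) * z ^ ((((1 - b) / a : ℝ)) : ℂ)

/-- `Q_j^±(ξ)`, the oscillatory integral of Lemma 4.3 of the paper. -/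
noncomputable def Qpm (n : ℕ) (a b s p ω c : ℝ) (cut : ℝ → ℝ) (m j : ℕ) (ε : ℝ)
    (ξ : EuclideanSpace ℝ (Fin n)) : ℂ :=
  ∫ r in Set.Ioi (0:ℝ), Complex.exp ((ε : ℂ) * Complex.I * r) * ((r ^ (c + m) : ℝ) : ℂ) *
    ((iteratedDeriv m (fun t => 1 - cut t) r : ℝ) : ℂ) *
    contourIntegral ω (fun z => mlKer a b z *
      ((r ^ ((j : ℝ) * s) / ‖ξ‖ ^ ((j : ℝ) * s) : ℝ) : ℂ) *
      ((z - Complex.exp (Complex.I * p) * ((r ^ s / ‖ξ‖ ^ s : ℝ) : ℂ)) ^ (j + 1))⁻¹)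

theorem integrableOn_rpow_mul_exp_Ioi_one {p b : ℝ} (hp : 0 < p) (hb : 0 < b) (s : ℝ) :
    IntegrableOn (fun x : ℝ => x ^ s * Real.exp (-b * x ^ p)) (Set.Ioi 1) := by
  have hq : (-1 : ℝ) < |s| := by linarith [abs_nonneg s]
  have hI : IntegrableOn (fun x : ℝ => x ^ |s| * Real.exp (-b * x ^ p)) (Set.Ioi 0) := by
    apply Integrable.of_integral_ne_zero
    rw [integral_rpow_mul_exp_neg_mul_rpow hp hq hb]
    have : 0 < Real.Gamma ((|s| + 1) / p) := Real.Gamma_pos_of_pos (by positivity)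
    positivity
  refine Integrable.mono' (hI.mono_set (Set.Ioi_subset_Ioi zero_le_one))
    (by fun_prop) ?_
  filter_upwards [ae_restrict_mem measurableSet_Ioi] with x hx
  have hx1 : (1 : ℝ) < x := hx
  rw [Real.norm_of_nonneg (by positivity)]
  gcongr
  · exact hx1.le
  · exact le_abs_self s

theorem measurable_mlKer (a b : ℝ) : Measurable (mlKer a b) := by
  unfold mlKer
  fun_prop

theorem re_cpow_polar {ρ θ : ℝ} (hρ : 0 < ρ) (hθ : |θ| < Real.pi) (s : ℝ) :
    (((ρ : ℂ) * Complex.exp (Complex.I * θ)) ^ (s : ℂ)).re = ρ ^ s * Real.cos (θ * s) := by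
  have hlog : Complex.log ((ρ : ℂ) * Complex.exp (Complex.I * θ))
      = Real.log ρ + Complex.I * θ := by
    rw [Complex.log_ofReal_mul hρ (Complex.exp_ne_zero _), Complex.log_exp]
    · simpa using (abs_lt.1 hθ).1
    · simpa using (abs_lt.1 hθ).2.le
  rw [Complex.cpow_def_of_ne_zero (mul_ne_zero (by exact_mod_cast hρ.ne') (Complex.exp_ne_zero _)),
    hlog, Complex.exp_re]
  simp [Real.rpow_def_of_pos hρ]

theorem norm_mlKer_polar {ρ θ : ℝ} (hρ : 0 < ρ) (hθ : |θ| < Real.pi) (a b : ℝ) :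
    ‖mlKer a b ((ρ : ℂ) * Complex.exp (Complex.I * θ))‖ =
      ρ ^ ((1 - b) / a) * Real.exp (Real.cos (θ * (1 / a)) * ρ ^ (1 / a)) := by
  rw [mlKer, norm_mul, Complex.norm_exp, re_cpow_polar hρ hθ, Complex.norm_cpow_real, norm_mul,
    mul_comm Complex.I, Complex.norm_exp_ofReal_mul_I, Complex.norm_of_nonneg hρ.le, mul_one,
    mul_comm, mul_comm (ρ ^ (1 / a))]

theorem integrableOn_mlKer_ray {a θ : ℝ} (ha : 0 < a) (b : ℝ) (hθ : |θ| < Real.pi)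
    (h1 : a * Real.pi / 2 < |θ|) (h2 : |θ| < a * Real.pi) :
    IntegrableOn (fun ρ : ℝ => mlKer a b ((ρ : ℂ) * Complex.exp (Complex.I * θ))
      * Complex.exp (Complex.I * θ)) (Set.Ioi 1) := by
  have hcos : Real.cos (θ * (1 / a)) < 0 := by
    rw [← Real.cos_abs, abs_mul, abs_of_pos (show 0 < 1 / a by positivity)]
    apply Real.cos_neg_of_pi_div_two_lt_of_lt
    · rw [mul_one_div, lt_div_iff₀ ha]; linarith
    · rw [mul_one_div, div_lt_iff₀ ha]; nlinarith [Real.pi_pos]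
  refine Integrable.mono' (integrableOn_rpow_mul_exp_Ioi_one (p := 1 / a) (by positivity)
    (neg_pos.2 hcos) ((1 - b) / a)) ?_ ?_
  · have := measurable_mlKer a b
    exact Measurable.aestronglyMeasurable (by fun_prop)
  · filter_upwards [ae_restrict_mem measurableSet_Ioi] with x hx
    have hx0 : (0 : ℝ) < x := zero_lt_one.trans hx
    rw [norm_mul, norm_mlKer_polar hx0 hθ, mul_comm Complex.I, Complex.norm_exp_ofReal_mul_I,
      mul_one, neg_neg]

theorem integrableOn_mlKer_arc {ω : ℝ} (hω : ω < Real.pi) (a b : ℝ) :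
    IntegrableOn (fun θ : ℝ => mlKer a b (Complex.exp (Complex.I * θ))
      * Complex.exp (Complex.I * θ)) (Set.Ioc (-ω) ω) := by
  have hm := measurable_mlKer a b
  refine Measure.integrableOn_of_bounded (M := Real.exp 1) measure_Ioc_lt_top.ne
    (by fun_prop) ?_
  filter_upwards [ae_restrict_mem measurableSet_Ioc] with θ hθ
  have h := norm_mlKer_polar (ρ := 1) (θ := θ) one_pos
    (abs_lt.2 ⟨by linarith [hθ.1], by linarith [hθ.2]⟩) a b
  rw [Complex.ofReal_one, one_mul] at h
  rw [norm_mul, h, mul_comm Complex.I, Complex.norm_exp_ofReal_mul_I]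
  simpa using Real.cos_le_one _

theorem sin_mul_le_norm_sub {ω φ ρ θ T : ℝ} (hρ : 0 ≤ ρ) (hT : 0 ≤ T) (hφ : |φ| ≤ Real.pi)
    (hωφ : ω < |φ|) (hθ : |θ| ≤ ω) :
    Real.sin (|φ| - ω) * T ≤
      ‖(ρ : ℂ) * Complex.exp (Complex.I * θ) - Complex.exp (Complex.I * φ) * (T : ℂ)‖ := by
  have hcos : Real.cos (θ - φ) ≤ Real.cos (|φ| - ω) := by
    calc Real.cos (θ - φ) = Real.cos θ * Real.cos φ + Real.sin θ * Real.sin φ := Real.cos_sub _ _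
      _ ≤ Real.cos |φ| * Real.cos |θ| + Real.sin |φ| * Real.sin |θ| := by
        have h1 : Real.sin |φ| = |Real.sin φ| :=
          (Real.abs_sin_eq_sin_abs_of_abs_le_pi hφ).symm
        have h2 : Real.sin |θ| = |Real.sin θ| :=
          (Real.abs_sin_eq_sin_abs_of_abs_le_pi (by linarith)).symm
        rw [Real.cos_abs, Real.cos_abs, h1, h2, ← abs_mul]
        have := le_abs_self (Real.sin φ * Real.sin θ)
        linarith
      _ = Real.cos (|φ| - |θ|) := (Real.cos_sub _ _).symm
      _ ≤ Real.cos (|φ| - ω) :=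
        Real.cos_le_cos_of_nonneg_of_le_pi (by linarith) (by linarith [abs_nonneg θ]) (by linarith)
  refine le_of_abs_le (abs_le_of_sq_le_sq ?_ (norm_nonneg _))
  have key : ‖(ρ : ℂ) * Complex.exp (Complex.I * θ) - Complex.exp (Complex.I * φ) * (T : ℂ)‖ ^ 2
      = ρ ^ 2 - 2 * (ρ * T) * Real.cos (θ - φ) + T ^ 2 := by
    rw [← Complex.normSq_eq_norm_sq, Complex.normSq_apply, Real.cos_sub]
    simp [mul_comm Complex.I, Complex.exp_ofReal_mul_I_re, Complex.exp_ofReal_mul_I_im]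
    linear_combination ρ ^ 2 * Real.sin_sq_add_cos_sq θ + T ^ 2 * Real.sin_sq_add_cos_sq φ
  rw [key, mul_pow, Real.sin_sq]
  have := mul_le_mul_of_nonneg_left hcos (mul_nonneg hρ hT)
  nlinarith [sq_nonneg (ρ - T * Real.cos (|φ| - ω))]

/-- The normalised resolvent power `T^(j+1) (z - e^{ip} T)^{-(j+1)}`. -/
noncomputable def scaledResolvent (p : ℝ) (j : ℕ) (T : ℝ) (z : ℂ) : ℂ :=
  (T : ℂ) ^ (j + 1) * ((z - Complex.exp (Complex.I * p) * (T : ℂ)) ^ (j + 1))⁻¹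

theorem measurable_scaledResolvent (p : ℝ) (j : ℕ) :
    Measurable (Function.uncurry (scaledResolvent p j)) := by
  unfold scaledResolvent Function.uncurry
  fun_prop

theorem norm_scaledResolvent_le {ω φ ρ θ T : ℝ} (hρ : 0 ≤ ρ) (hT : 0 < T) (hφ : |φ| ≤ Real.pi)
    (hωφ : ω < |φ|) (hθ : |θ| ≤ ω) (hω : 0 < ω) (j : ℕ) :
    ‖scaledResolvent φ j T ((ρ : ℂ) * Complex.exp (Complex.I * θ))‖ ≤
      ((Real.sin (|φ| - ω))⁻¹) ^ (j + 1) := by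
  have hs : 0 < Real.sin (|φ| - ω) := Real.sin_pos_of_pos_of_lt_pi (by linarith) (by linarith)
  have h := sin_mul_le_norm_sub hρ hT.le hφ hωφ hθ
  rw [scaledResolvent, ← inv_pow, ← mul_pow, norm_pow, norm_mul, norm_inv,
    Complex.norm_of_nonneg hT.le]
  gcongr
  rw [← div_eq_mul_inv, div_le_iff₀ (lt_of_lt_of_le (by positivity) h)]
  calc T = (Real.sin (|φ| - ω))⁻¹ * (Real.sin (|φ| - ω) * T) := by field_simp
    _ ≤ _ := by gcongr

theorem tendsto_scaledResolvent (φ : ℝ) (j : ℕ) (z : ℂ) :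
    Tendsto (fun T => scaledResolvent φ j T z) atTop
      (𝓝 (Complex.exp (Complex.I * ((j : ℂ) + 1) * ((Real.pi : ℂ) - (φ : ℂ))))) := by
  have hlim : (Complex.exp (Complex.I * ((j : ℂ) + 1) * ((Real.pi : ℂ) - (φ : ℂ))))
      = ((z * 0 - Complex.exp (Complex.I * φ))⁻¹) ^ (j + 1) := by
    rw [mul_zero, zero_sub, inv_neg, ← Complex.exp_neg, neg_eq_neg_one_mul, ← Complex.exp_pi_mul_I,
      ← Complex.exp_add, ← Complex.exp_nat_mul]
    congr 1
    push_cast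
    ring
  rw [hlim]
  have hinv : Tendsto (fun T : ℝ => ((T : ℂ))⁻¹) atTop (𝓝 0) := by
    have := (Complex.continuous_ofReal.tendsto 0).comp tendsto_inv_atTop_zero
    simpa [Function.comp_def] using this
  have h1 : Tendsto (fun T : ℝ => ((z * (T : ℂ)⁻¹ - Complex.exp (Complex.I * φ))⁻¹) ^ (j + 1))
      atTop (𝓝 (((z * 0 - Complex.exp (Complex.I * φ))⁻¹) ^ (j + 1))) := by
    refine Tendsto.pow (Tendsto.inv₀ ((hinv.const_mul z).sub_const _) ?_) _
    simp [Complex.exp_ne_zero]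
  refine h1.congr' ?_
  filter_upwards [eventually_gt_atTop 0] with T hT
  have hT' : (T : ℂ) ≠ 0 := by exact_mod_cast hT.ne'
  rw [scaledResolvent, ← inv_pow, ← mul_pow]
  congr 1
  have : z - Complex.exp (Complex.I * φ) * (T : ℂ)
      = T * (z * (T : ℂ)⁻¹ - Complex.exp (Complex.I * φ)) := by field_simp
  rw [this, mul_inv, mul_inv_cancel_left₀ hT']

section BoundedFamily

variable {μ : Measure ℝ} {k : ℂ → ℂ} {h : ℝ → ℂ → ℂ} {M : ℝ} (γ w : ℝ → ℂ)

theorem norm_integral_mul_mul_le (hkw : Integrable (fun t => k (γ t) * w t) μ) {T : ℝ}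
    (hb : ∀ᵐ t ∂μ, ‖h T (γ t)‖ ≤ M) :
    ‖∫ t, k (γ t) * h T (γ t) * w t ∂μ‖ ≤ ∫ t, M * ‖k (γ t) * w t‖ ∂μ := by
  refine norm_integral_le_of_norm_le (hkw.norm.const_mul M) ?_
  filter_upwards [hb] with t ht
  rw [mul_right_comm, norm_mul, mul_comm]
  gcongr

theorem tendsto_integral_mul_mul (hk : Measurable k) (hγ : Measurable γ) (hw : Measurable w)
    (hh : Measurable (Function.uncurry h)) (hkw : Integrable (fun t => k (γ t) * w t) μ)
    (hb : ∀ T > 0, ∀ᵐ t ∂μ, ‖h T (γ t)‖ ≤ M) {L : ℂ}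
    (hlim : ∀ z, Tendsto (fun T => h T z) atTop (𝓝 L)) :
    Tendsto (fun T => ∫ t, k (γ t) * h T (γ t) * w t ∂μ) atTop
      (𝓝 (L * ∫ t, k (γ t) * w t ∂μ)) := by
  rw [← integral_const_mul]
  refine tendsto_integral_filter_of_dominated_convergence (fun t => M * ‖k (γ t) * w t‖) ?_ ?_
    (hkw.norm.const_mul M) ?_
  · refine Eventually.of_forall fun T => Measurable.aestronglyMeasurable ?_
    have : Measurable (h T) := hh.comp measurable_prodMk_left
    fun_prop
  · filter_upwards [eventually_gt_atTop 0] with T hT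
    filter_upwards [hb T hT] with t ht
    rw [mul_right_comm, norm_mul, mul_comm]
    gcongr
  · refine Eventually.of_forall fun t => ?_
    have := ((hlim (γ t)).const_mul (k (γ t))).mul_const (w t)
    rwa [mul_comm (k (γ t)) L, mul_assoc] at this

theorem measurable_integral_mul_mul [SFinite μ] (hk : Measurable k) (hγ : Measurable γ)
    (hw : Measurable w) (hh : Measurable (Function.uncurry h)) :
    Measurable (fun T => ∫ t, k (γ t) * h T (γ t) * w t ∂μ) := by
  refine StronglyMeasurable.measurable (StronglyMeasurable.integral_prod_right
    (f := fun T t => k (γ t) * h T (γ t) * w t) (Measurable.stronglyMeasurable ?_))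
  exact ((hk.comp (hγ.comp measurable_snd)).mul
    (hh.comp (measurable_fst.prodMk (hγ.comp measurable_snd)))).mul (hw.comp measurable_snd)

end BoundedFamily

theorem contourIntegral_eq {ω : ℝ} (hω : 0 ≤ ω) (F : ℂ → ℂ) :
    contourIntegral ω F =
      (∫ ρ in Set.Ioi (1 : ℝ), F ((ρ : ℂ) * Complex.exp (Complex.I * ω)) *
        Complex.exp (Complex.I * ω)) -
      (∫ ρ in Set.Ioi (1 : ℝ), F ((ρ : ℂ) * Complex.exp (Complex.I * (-ω : ℝ))) *
        Complex.exp (Complex.I * (-ω : ℝ))) +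
      Complex.I * ∫ θ in Set.Ioc (-ω) ω, F (Complex.exp (Complex.I * θ)) *
        Complex.exp (Complex.I * θ) := by
  rw [contourIntegral, intervalIntegral.integral_of_le (by linarith)]
  simp

theorem contourIntegral_const_mul (ω : ℝ) (c : ℂ) (F : ℂ → ℂ) :
    contourIntegral ω (fun z => c * F z) = c * contourIntegral ω F := by
  simp only [contourIntegral, mul_assoc, integral_const_mul, intervalIntegral.integral_const_mul]
  ring

/-- The contour integral of `mlKer a b` against the normalised resolvent power. -/
noncomputable def mlResolvent (a b p ω : ℝ) (j : ℕ) (T : ℝ) : ℂ :=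
  contourIntegral ω (fun z => mlKer a b z * scaledResolvent p j T z)

theorem measurable_mlResolvent {ω : ℝ} (hω : 0 ≤ ω) (a b p : ℝ) (j : ℕ) :
    Measurable (mlResolvent a b p ω j) := by
  have hK := measurable_mlKer a b
  have hH := measurable_scaledResolvent p j
  unfold mlResolvent
  simp only [contourIntegral_eq hω]
  have hray := fun θ : ℝ => measurable_integral_mul_mul (μ := volume.restrict (Set.Ioi 1))
    (fun ρ : ℝ => (ρ : ℂ) * Complex.exp (Complex.I * θ)) (fun _ => Complex.exp (Complex.I * θ))
    hK (by fun_prop) (by fun_prop) hH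
  have harc := measurable_integral_mul_mul (μ := volume.restrict (Set.Ioc (-ω) ω))
    (fun θ : ℝ => Complex.exp (Complex.I * θ)) (fun θ : ℝ => Complex.exp (Complex.I * θ))
    hK (by fun_prop) (by fun_prop) hH
  exact ((hray ω).sub (hray (-ω))).add (harc.const_mul Complex.I)

section Estimates

variable {α φ ω : ℝ}

theorem norm_mlResolvent_le_and_tendsto (β : ℝ) (hα : 0 < α) (hφ : |φ| ≤ Real.pi)
    (h1 : α * Real.pi / 2 < ω) (h2 : ω < |φ|) (h3 : ω < α * Real.pi) (j : ℕ) :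
    (∃ B, ∀ T > 0, ‖mlResolvent α β φ ω j T‖ ≤ B) ∧
    Tendsto (mlResolvent α β φ ω j) atTop
      (𝓝 (Complex.exp (Complex.I * ((j : ℂ) + 1) * ((Real.pi : ℂ) - (φ : ℂ))) *
        contourIntegral ω (mlKer α β))) := by
  have hω : 0 < ω := lt_trans (by positivity) h1
  have hωπ : ω < Real.pi := by linarith
  have hK := measurable_mlKer α β
  have hH := measurable_scaledResolvent φ j
  have hray : ∀ θ : ℝ, |θ| = ω → IntegrableOn (fun ρ : ℝ =>
      mlKer α β ((ρ : ℂ) * Complex.exp (Complex.I * θ)) * Complex.exp (Complex.I * θ))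
      (Set.Ioi 1) := fun θ hθ =>
    integrableOn_mlKer_ray hα β (by rwa [hθ]) (by rwa [hθ]) (by rwa [hθ])
  have hrayb : ∀ θ : ℝ, |θ| = ω → ∀ T > 0, ∀ᵐ ρ : ℝ ∂(volume.restrict (Set.Ioi 1)),
      ‖scaledResolvent φ j T ((ρ : ℂ) * Complex.exp (Complex.I * θ))‖ ≤
        ((Real.sin (|φ| - ω))⁻¹) ^ (j + 1) := by
    intro θ hθ T hT
    filter_upwards [ae_restrict_mem measurableSet_Ioi] with ρ hρ
    exact norm_scaledResolvent_le (zero_le_one.trans (le_of_lt hρ)) hT hφ h2 hθ.le hω j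
  have harcb : ∀ T > 0, ∀ᵐ θ : ℝ ∂(volume.restrict (Set.Ioc (-ω) ω)),
      ‖scaledResolvent φ j T (Complex.exp (Complex.I * θ))‖ ≤
        ((Real.sin (|φ| - ω))⁻¹) ^ (j + 1) := by
    intro T hT
    filter_upwards [ae_restrict_mem measurableSet_Ioc] with θ hθ
    simpa using norm_scaledResolvent_le (ρ := 1) (θ := θ) zero_le_one hT hφ h2
      (abs_le.2 ⟨hθ.1.le, hθ.2⟩) hω j
  have hp : |ω| = ω := abs_of_pos hω
  have hn : |-ω| = ω := by rw [abs_neg, hp]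
  have harc := integrableOn_mlKer_arc hωπ α β
  constructor
  · have hR := fun (θ : ℝ) (hθ : |θ| = ω) (T : ℝ) (hT : 0 < T) => norm_integral_mul_mul_le
      (fun ρ : ℝ => (ρ : ℂ) * Complex.exp (Complex.I * θ)) (fun _ => Complex.exp (Complex.I * θ))
      (hray θ hθ) (hrayb θ hθ T hT)
    have hA := fun (T : ℝ) (hT : 0 < T) => norm_integral_mul_mul_le
      (fun θ : ℝ => Complex.exp (Complex.I * θ)) (fun θ : ℝ => Complex.exp (Complex.I * θ))
      harc (harcb T hT)
    have hnorm : ∀ {x y z : ℂ} {A B C : ℝ}, ‖x‖ ≤ A → ‖y‖ ≤ B → ‖z‖ ≤ C →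
        ‖x - y + Complex.I * z‖ ≤ A + B + C := by
      intro x y z A B C hx hy hz
      have hIz : ‖Complex.I * z‖ ≤ C := by rwa [norm_mul, Complex.norm_I, one_mul]
      exact norm_add_le_of_le (norm_sub_le_of_le hx hy) hIz
    exact ⟨_, fun T hT => (congrArg norm (contourIntegral_eq hω.le _)).trans_le
      (hnorm (hR ω hp T hT) (hR (-ω) hn T hT) (hA T hT))⟩
  · have hR := fun (θ : ℝ) (hθ : |θ| = ω) => tendsto_integral_mul_mul
      (fun ρ : ℝ => (ρ : ℂ) * Complex.exp (Complex.I * θ)) (fun _ => Complex.exp (Complex.I * θ))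
      hK (by fun_prop) (by fun_prop) hH (hray θ hθ) (hrayb θ hθ) (tendsto_scaledResolvent φ j)
    have hA := tendsto_integral_mul_mul
      (fun θ : ℝ => Complex.exp (Complex.I * θ)) (fun θ : ℝ => Complex.exp (Complex.I * θ))
      hK (by fun_prop) (by fun_prop) hH harc harcb (tendsto_scaledResolvent φ j)
    unfold mlResolvent
    simp only [contourIntegral_eq hω.le]
    rw [mul_add, mul_sub, mul_left_comm _ Complex.I]
    exact ((hR ω hp).sub (hR (-ω) hn)).add (hA.const_mul Complex.I)

end Estimates

theorem contourIntegral_mlKer_mul_resolvent (α β φ ω : ℝ) {σ r x : ℝ} (hr : 0 < r) (hx : 0 < x)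
    (j : ℕ) :
    contourIntegral ω (fun z => mlKer α β z *
        ((r ^ ((j : ℝ) * σ) / x ^ ((j : ℝ) * σ) : ℝ) : ℂ) *
        ((z - Complex.exp (Complex.I * φ) * ((r ^ σ / x ^ σ : ℝ) : ℂ)) ^ (j + 1))⁻¹) =
      ((x ^ σ * r ^ (-σ) : ℝ) : ℂ) * mlResolvent α β φ ω j (r ^ σ / x ^ σ) := by
  rw [mlResolvent, ← contourIntegral_const_mul]
  congr 1
  ext z
  have hpow : r ^ ((j : ℝ) * σ) / x ^ ((j : ℝ) * σ) =
      x ^ σ * r ^ (-σ) * (r ^ σ / x ^ σ) ^ (j + 1) := by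
    have h1 : 0 < r ^ σ := Real.rpow_pos_of_pos hr σ
    have h2 : 0 < x ^ σ := Real.rpow_pos_of_pos hx σ
    rw [mul_comm (j : ℝ), Real.rpow_mul_natCast hr.le, Real.rpow_mul_natCast hx.le,
      Real.rpow_neg hr.le, pow_succ, div_pow]
    field_simp
  rw [hpow, scaledResolvent]
  push_cast
  ring

theorem integrableOn_rpow_mul_iteratedDeriv_cutoff {φ₀ : ℝ → ℝ} (hs : ContDiff ℝ (⊤ : ℕ∞) φ₀)
    (hone : ∀ r ∈ Set.Icc (-1 : ℝ) 1, φ₀ r = 1)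
    (hsupp : Function.support φ₀ ⊆ Set.Icc (-2 : ℝ) 2) {c : ℝ} (m : ℕ) (hc : c < m - 1) :
    IntegrableOn (fun r : ℝ => r ^ c * iteratedDeriv m (fun t => 1 - φ₀ t) r) (Set.Ioi 0) := by
  have hcont : Continuous (iteratedDeriv m (fun t => 1 - φ₀ t)) :=
    (contDiff_const.sub hs).continuous_iteratedDeriv m (by exact_mod_cast le_top)
  have hsmall : ∀ r ∈ Set.Ioo (0 : ℝ) 1, iteratedDeriv m (fun t => 1 - φ₀ t) r = 0 := by
    intro r hr
    have : (fun t => 1 - φ₀ t) =ᶠ[𝓝 r] fun _ => 0 := by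
      filter_upwards [Ioo_mem_nhds hr.1 hr.2] with t ht
      rw [hone t ⟨by linarith [ht.1], ht.2.le⟩, sub_self]
    rw [this.iteratedDeriv_eq m]
    simp
  have hlarge : ∀ r ∈ Set.Ioi (2 : ℝ),
      iteratedDeriv m (fun t => 1 - φ₀ t) r = if m = 0 then 1 else 0 := by
    intro r hr
    have : (fun t => 1 - φ₀ t) =ᶠ[𝓝 r] fun _ => 1 := by
      filter_upwards [Ioi_mem_nhds hr] with t ht
      have h0 : φ₀ t = 0 := by
        by_contra h
        exact absurd (hsupp h).2 (not_le.2 ht)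
      rw [h0, sub_zero]
    rw [this.iteratedDeriv_eq m]
    simp [iteratedDeriv_const]
  have hcover : Set.Ioi (0 : ℝ) ⊆ (Set.Ioo 0 1 ∪ Set.Icc 1 2) ∪ Set.Ioi 2 := by
    intro r hr
    have hr0 : (0 : ℝ) < r := hr
    rcases lt_or_ge r 1 with h | h
    · exact Or.inl (Or.inl ⟨hr0, h⟩)
    · rcases le_or_gt r 2 with h' | h'
      · exact Or.inl (Or.inr ⟨h, h'⟩)
      · exact Or.inr h'
  refine IntegrableOn.mono_set (IntegrableOn.union (IntegrableOn.union ?_ ?_) ?_) hcover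
  · refine (integrableOn_zero).congr_fun (fun r hr => ?_) measurableSet_Ioo
    simp [hsmall r hr]
  · refine ContinuousOn.integrableOn_Icc (ContinuousOn.mul (fun r hr => ?_) hcont.continuousOn)
    exact (Real.continuousAt_rpow_const _ _
      (Or.inl (by linarith [hr.1]))).continuousWithinAt
  · rcases eq_or_ne m 0 with rfl | hm
    · refine (integrableOn_Ioi_rpow_of_lt (by simpa using hc) two_pos).congr_fun
        (fun r hr => ?_) measurableSet_Ioi
      simp only [hlarge r hr, if_true, mul_one]
    · refine (integrableOn_zero).congr_fun (fun r hr => ?_) measurableSet_Ioi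
      simp [hlarge r hr, hm]

theorem stmt15 (n : ℕ) (hn : 1 ≤ n) (α β σ φ : ℝ)
    (hα0 : 0 < α) (hα2 : α < 2) (hβ : 0 < β) (hσ0 : 0 < σ)
    (hφ1 : -Real.pi < φ) (hφ2 : φ ≤ Real.pi) (hφα : α * Real.pi / 2 < |φ|) (ω : ℝ) (hω1 : α * Real.pi / 2 < ω) (hω2 : ω < |φ|) (hω3 : ω < α * Real.pi) (hω4 : ω < Real.pi) (φ₀ : ℝ → ℝ) (hcut_smooth : ContDiff ℝ (⊤ : ℕ∞) φ₀)
    (hcut_range : ∀ r, 0 ≤ φ₀ r ∧ φ₀ r ≤ 1)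
    (hcut_one : ∀ r ∈ Set.Icc (-1:ℝ) 1, φ₀ r = 1)
    (hcut_supp : Function.support φ₀ ⊆ Set.Icc (-2:ℝ) 2)
    (a : ℝ) (ha : a < -1) (m j : ℕ) (ε : ℝ) (hε : ε = 1 ∨ ε = -1) :
    (∀ ξ : EuclideanSpace ℝ (Fin n), ξ ≠ 0 →
      IntegrableOn (fun r : ℝ => Complex.exp ((ε : ℂ) * Complex.I * r) *
          ((r ^ (a + m) : ℝ) : ℂ) * ((iteratedDeriv m (fun t => 1 - φ₀ t) r : ℝ) : ℂ) *
          contourIntegral ω (fun z => mlKer α β z *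
            ((r ^ ((j : ℝ) * σ) / ‖ξ‖ ^ ((j : ℝ) * σ) : ℝ) : ℂ) *
            ((z - Complex.exp (Complex.I * φ) * ((r ^ σ / ‖ξ‖ ^ σ : ℝ) : ℂ)) ^ (j + 1))⁻¹))
        (Set.Ioi (0:ℝ)) volume) ∧
    Tendsto (fun ξ : EuclideanSpace ℝ (Fin n) =>
        ((‖ξ‖ ^ (-σ) : ℝ) : ℂ) * Qpm n α β σ φ ω a φ₀ m j ε ξ)
      (𝓝[≠] 0)
      (𝓝 (Complex.exp (Complex.I * ((j : ℂ) + 1) * ((Real.pi : ℂ) - (φ : ℂ))) *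
        contourIntegral ω (mlKer α β) *
        ∫ r in Set.Ioi (0:ℝ), Complex.exp ((ε : ℂ) * Complex.I * r) *
          ((r ^ (a + m - σ) : ℝ) : ℂ) *
          ((iteratedDeriv m (fun t => 1 - φ₀ t) r : ℝ) : ℂ))) := by
  have hω : 0 < ω := lt_trans (by positivity) hω1
  obtain ⟨⟨B, hB⟩, hlim⟩ := norm_mlResolvent_le_and_tendsto (φ := φ) β hα0
    (abs_le.2 ⟨hφ1.le, hφ2⟩) hω1 hω2 hω3 j
  have hmeas := measurable_mlResolvent hω.le α β φ j
  have hψ : Measurable (iteratedDeriv m (fun t => 1 - φ₀ t)) :=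
    ((contDiff_const.sub hcut_smooth).continuous_iteratedDeriv m
      (by exact_mod_cast le_top)).measurable
  have hint := integrableOn_rpow_mul_iteratedDeriv_cutoff hcut_smooth hcut_one hcut_supp
    (c := a + m - σ) m (by linarith)
  set A : ℝ → ℂ := fun r => Complex.exp ((ε : ℂ) * Complex.I * r) *
    ((r ^ (a + m - σ) : ℝ) : ℂ) * ((iteratedDeriv m (fun t => 1 - φ₀ t) r : ℝ) : ℂ) with hA
  have hAmeas : Measurable A := by fun_prop
  have hAnorm : ∀ r, ‖A r‖ = ‖r ^ (a + m - σ) * iteratedDeriv m (fun t => 1 - φ₀ t) r‖ := by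
    intro r
    have : ‖Complex.exp ((ε : ℂ) * Complex.I * r)‖ = 1 := by
      rw [show (ε : ℂ) * Complex.I * r = ((ε * r : ℝ) : ℂ) * Complex.I by push_cast; ring,
        Complex.norm_exp_ofReal_mul_I]
    simp only [hA, norm_mul, this, Complex.norm_real, one_mul]
  have hdom : ∀ x : ℝ, 0 < x → ∀ r ∈ Set.Ioi (0 : ℝ),
      ‖A r * mlResolvent α β φ ω j (r ^ σ / x ^ σ)‖ ≤
        ‖r ^ (a + m - σ) * iteratedDeriv m (fun t => 1 - φ₀ t) r‖ * B := by
    intro x hx r hr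
    have hr0 : (0 : ℝ) < r := hr
    rw [norm_mul, hAnorm]
    gcongr
    exact hB _ (by positivity)
  have hAGmeas : ∀ x : ℝ, Measurable fun r => A r * mlResolvent α β φ ω j (r ^ σ / x ^ σ) := by
    intro x
    fun_prop
  have hkey : ∀ x : ℝ, 0 < x → ∀ r ∈ Set.Ioi (0 : ℝ),
      Complex.exp ((ε : ℂ) * Complex.I * r) *
          ((r ^ (a + m) : ℝ) : ℂ) * ((iteratedDeriv m (fun t => 1 - φ₀ t) r : ℝ) : ℂ) *
          contourIntegral ω (fun z => mlKer α β z *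
            ((r ^ ((j : ℝ) * σ) / x ^ ((j : ℝ) * σ) : ℝ) : ℂ) *
            ((z - Complex.exp (Complex.I * φ) * ((r ^ σ / x ^ σ : ℝ) : ℂ)) ^ (j + 1))⁻¹) =
        ((x ^ σ : ℝ) : ℂ) * (A r * mlResolvent α β φ ω j (r ^ σ / x ^ σ)) := by
    intro x hx r hr
    rw [contourIntegral_mlKer_mul_resolvent α β φ ω hr hx, hA]
    have : r ^ (a + m - σ) = r ^ (a + m) * r ^ (-σ) := by
      rw [← Real.rpow_add hr, sub_eq_add_neg]
    simp only [this]
    push_cast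
    ring
  constructor
  · intro ξ hξ
    have hx : 0 < ‖ξ‖ := norm_pos_iff.2 hξ
    refine IntegrableOn.congr_fun (Integrable.const_mul (Integrable.mono' (hint.norm.mul_const B)
      (hAGmeas ‖ξ‖).aestronglyMeasurable ?_) ((‖ξ‖ ^ σ : ℝ) : ℂ))
      (fun r hr => (hkey ‖ξ‖ hx r hr).symm) measurableSet_Ioi
    filter_upwards [ae_restrict_mem measurableSet_Ioi] with r hr using hdom _ hx r hr
  · rw [← integral_const_mul]
    have hne : ∀ᶠ ξ : EuclideanSpace ℝ (Fin n) in 𝓝[≠] 0, 0 < ‖ξ‖ := by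
      filter_upwards [self_mem_nhdsWithin] with ξ hξ using norm_pos_iff.2 hξ
    have hnorm : Tendsto (fun ξ : EuclideanSpace ℝ (Fin n) => ‖ξ‖ ^ σ) (𝓝[≠] 0) (𝓝[>] 0) := by
      refine tendsto_nhdsWithin_iff.2 ⟨?_, hne.mono fun ξ h => Real.rpow_pos_of_pos h σ⟩
      have hc : ContinuousAt (fun ξ : EuclideanSpace ℝ (Fin n) => ‖ξ‖ ^ σ) 0 :=
        continuous_norm.continuousAt.rpow_const (Or.inr hσ0.le)
      have := hc.tendsto
      rw [norm_zero, Real.zero_rpow hσ0.ne'] at this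
      exact this.mono_left nhdsWithin_le_nhds
    have hdct : Tendsto (fun ξ : EuclideanSpace ℝ (Fin n) =>
        ∫ r in Set.Ioi (0 : ℝ), A r * mlResolvent α β φ ω j (r ^ σ / ‖ξ‖ ^ σ)) (𝓝[≠] 0)
        (𝓝 (∫ r in Set.Ioi (0 : ℝ), Complex.exp (Complex.I * ((j : ℂ) + 1) *
          ((Real.pi : ℂ) - (φ : ℂ))) * contourIntegral ω (mlKer α β) * A r)) := by
      refine tendsto_integral_filter_of_dominated_convergence _
        (Eventually.of_forall fun ξ => (hAGmeas ‖ξ‖).aestronglyMeasurable) ?_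
        (hint.norm.mul_const B) ?_
      · filter_upwards [hne] with ξ hξ
        filter_upwards [ae_restrict_mem measurableSet_Ioi] with r hr using hdom _ hξ r hr
      · filter_upwards [ae_restrict_mem measurableSet_Ioi] with r hr
        have hT : Tendsto (fun ξ : EuclideanSpace ℝ (Fin n) => r ^ σ / ‖ξ‖ ^ σ) (𝓝[≠] 0) atTop :=
          (tendsto_inv_nhdsGT_zero.comp hnorm).const_mul_atTop (Real.rpow_pos_of_pos hr σ)
        rw [mul_comm _ (A r)]
        exact (hlim.comp hT).const_mul (A r)
    refine hdct.congr' ?_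
    filter_upwards [hne] with ξ hξ
    rw [Qpm, setIntegral_congr_fun measurableSet_Ioi (hkey ‖ξ‖ hξ), integral_const_mul,
      ← mul_assoc, ← Complex.ofReal_mul, ← Real.rpow_add hξ, neg_add_cancel, Real.rpow_zero,
      Complex.ofReal_one, one_mul]
end
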